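/- arXiv:2505.12929 — 3 statements merged into one kernel-verified Lean document; each statement's English description precedes it below -/
import Mathlib

section
/- Let N ≥ 2, let a ∈ ℝ^N be a vector of logits, and let π ∈ ℝ^N be its softmax, π(n) = exp(a(n)) / Σ_{m=1}^N exp(a(m)). Fix an index k and a real number w, and set δ_L = w · (e_k − π) ∈ ℝ^N, where e_k is the k-th standard basis vector. Let A_{ℓ+1}, …, A_L be linear maps between finite-dimensional real inner product spaces (with A_L defined on ℝ^N) such that for each j there exist constants c_j > 0 and d_j > 0 with c_j‖x‖ ≤ ‖A_j x‖ ≤ d_j‖x‖ for all x, and define δ_ℓ = A_{ℓ+1}(A_{ℓ+2}(⋯ A_L(δ_L)⋯)). Then (∏_{j=ℓ+1}^L c_j) · |w| · √(N/(N−1)) · (1 − π(k)) ≤ ‖δ_ℓ‖ ≤ (∏_{j=ℓ+1}^L d_j) · |w| · √2 · (1 − π(k)), where ‖·‖ denotes the Euclidean (ℓ²) norm. -/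
/-- Composition of a chain of linear maps `W 0 → W 1 → ⋯ → W m`, where `A i : W i → W (i+1)`:
`chainUp A m = A (m-1) ∘ ⋯ ∘ A 1 ∘ A 0`. -/
def chainUp {W : ℕ → Type} [∀ i, NormedAddCommGroup (W i)] [∀ i, InnerProductSpace ℝ (W i)]
    (A : ∀ i, W i →ₗ[ℝ] W (i + 1)) : ∀ m, W 0 →ₗ[ℝ] W m
  | 0 => LinearMap.id
  | m + 1 => (A m).comp (chainUp A m)

/-- Lower bounds on the factors of a chain multiply. -/
theorem prod_mul_norm_le_norm_chainUp {W : ℕ → Type} [∀ i, NormedAddCommGroup (W i)]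
    [∀ i, InnerProductSpace ℝ (W i)] (A : ∀ i, W i →ₗ[ℝ] W (i + 1)) (c : ℕ → ℝ) (m : ℕ)
    (hc : ∀ i < m, 0 ≤ c i) (hA : ∀ i < m, ∀ x : W i, c i * ‖x‖ ≤ ‖A i x‖) (x : W 0) :
    (∏ i ∈ Finset.range m, c i) * ‖x‖ ≤ ‖chainUp A m x‖ := by
  induction m with
  | zero => simp [chainUp]
  | succ m ih =>
    have ih' := ih (fun i hi => hc i (by omega)) (fun i hi => hA i (by omega))
    calc (∏ i ∈ Finset.range (m + 1), c i) * ‖x‖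
        = c m * ((∏ i ∈ Finset.range m, c i) * ‖x‖) := by
          rw [Finset.prod_range_succ]; ring
      _ ≤ c m * ‖chainUp A m x‖ := mul_le_mul_of_nonneg_left ih' (hc m (by omega))
      _ ≤ ‖chainUp A (m + 1) x‖ := hA m (by omega) _

/-- Upper bounds on the factors of a chain multiply. -/
theorem norm_chainUp_le_prod_mul_norm {W : ℕ → Type} [∀ i, NormedAddCommGroup (W i)]
    [∀ i, InnerProductSpace ℝ (W i)] (A : ∀ i, W i →ₗ[ℝ] W (i + 1)) (d : ℕ → ℝ) (m : ℕ)
    (hd : ∀ i < m, 0 ≤ d i) (hA : ∀ i < m, ∀ x : W i, ‖A i x‖ ≤ d i * ‖x‖) (x : W 0) :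
    ‖chainUp A m x‖ ≤ (∏ i ∈ Finset.range m, d i) * ‖x‖ := by
  induction m with
  | zero => simp [chainUp]
  | succ m ih =>
    have ih' := ih (fun i hi => hd i (by omega)) (fun i hi => hA i (by omega))
    calc ‖chainUp A (m + 1) x‖ ≤ d m * ‖chainUp A m x‖ := hA m (by omega) _
      _ ≤ d m * ((∏ i ∈ Finset.range m, d i) * ‖x‖) :=
          mul_le_mul_of_nonneg_left ih' (hd m (by omega))
      _ = (∏ i ∈ Finset.range (m + 1), d i) * ‖x‖ := by
          rw [Finset.prod_range_succ]; ring

/-- The distance from a probability vector to a vertex of the simplex. -/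
theorem norm_single_sub_bounds {N : ℕ} (hN : 2 ≤ N) (p : EuclideanSpace ℝ (Fin N))
    (hp : ∀ n, 0 ≤ p n) (hsum : ∑ n, p n = 1) (k : Fin N) :
    Real.sqrt ((N : ℝ) / ((N : ℝ) - 1)) * (1 - p k) ≤ ‖EuclideanSpace.single k (1 : ℝ) - p‖ ∧
      ‖EuclideanSpace.single k (1 : ℝ) - p‖ ≤ Real.sqrt 2 * (1 - p k) := by
  have hrest : ∑ n ∈ Finset.univ.erase k, p n = 1 - p k := by
    have := Finset.add_sum_erase Finset.univ (fun n => p n) (Finset.mem_univ k)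
    linarith
  have hnonneg : 0 ≤ 1 - p k := hrest ▸ Finset.sum_nonneg fun n _ => hp n
  have hN' : (0 : ℝ) < (N : ℝ) - 1 := by
    have : (2 : ℝ) ≤ N := by exact_mod_cast hN
    linarith
  have hnorm : ‖EuclideanSpace.single k (1 : ℝ) - p‖ ^ 2
      = (1 - p k) ^ 2 + ∑ n ∈ Finset.univ.erase k, p n ^ 2 := by
    rw [EuclideanSpace.real_norm_sq_eq, ← Finset.add_sum_erase Finset.univ _ (Finset.mem_univ k)]
    congr 1
    · simp
    · refine Finset.sum_congr rfl fun n hn => ?_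
      simp [Finset.ne_of_mem_erase hn]
  have hupper : ∑ n ∈ Finset.univ.erase k, p n ^ 2 ≤ (1 - p k) ^ 2 :=
    hrest ▸ Finset.sum_sq_le_sq_sum_of_nonneg fun n _ => hp n
  have hlower : (1 - p k) ^ 2 ≤ ((N : ℝ) - 1) * ∑ n ∈ Finset.univ.erase k, p n ^ 2 := by
    have h := sq_sum_le_card_mul_sum_sq (s := Finset.univ.erase k) (f := fun n => p n)
    rw [hrest, Finset.card_erase_of_mem (Finset.mem_univ k), Finset.card_univ, Fintype.card_fin,
      Nat.cast_sub (by omega), Nat.cast_one] at h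
    exact h
  constructor
  · refine (sq_le_sq₀ (by positivity) (norm_nonneg _)).mp ?_
    rw [mul_pow, Real.sq_sqrt (by positivity), hnorm, div_mul_eq_mul_div, div_le_iff₀ hN']
    linarith
  · refine (sq_le_sq₀ (norm_nonneg _) (by positivity)).mp ?_
    rw [mul_pow, Real.sq_sqrt (by norm_num), hnorm]
    linarith

/-- **Proposition 4.2.**
Let `N ≥ 2`, let `π` be the softmax of the logits `a ∈ ℝ^N`, fix an index `k` and a weight
`w ∈ ℝ`, and set `δ_L = w • (e_k − π)`.  Let `A₀ : ℝ^N → W 0` (playing the role of `A_L`)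
and `A i : W i → W (i+1)` for `i < m` (playing the roles of `A_{L-1}, …, A_{ℓ+1}`) be linear
maps between finite-dimensional real inner product spaces whose singular values are bounded
below by `c j > 0` and above by `d j > 0` (the map with constants `c 0, d 0` being `A₀` and
the one with constants `c (i+1), d (i+1)` being `A i`).  Then the gradient
`δ_ℓ = A_{ℓ+1}(A_{ℓ+2}(⋯ A_L(δ_L)⋯))` at the intermediate layer satisfies
`(∏ c j) · |w| · √(N/(N−1)) · (1 − π k) ≤ ‖δ_ℓ‖ ≤ (∏ d j) · |w| · √2 · (1 − π k)`. -/
theorem grpo_gradient_norm_bounds {N : ℕ} (hN : 2 ≤ N)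
    (a π : EuclideanSpace ℝ (Fin N))
    (hπ : ∀ n, π n = Real.exp (a n) / ∑ m, Real.exp (a m))
    (k : Fin N) (w : ℝ) (δL : EuclideanSpace ℝ (Fin N))
    (hδL : δL = w • (EuclideanSpace.single k (1 : ℝ) - π))
    (m : ℕ) (W : ℕ → Type)
    [∀ i, NormedAddCommGroup (W i)] [∀ i, InnerProductSpace ℝ (W i)]
    [∀ i, FiniteDimensional ℝ (W i)]
    (A₀ : EuclideanSpace ℝ (Fin N) →ₗ[ℝ] W 0) (A : ∀ i, W i →ₗ[ℝ] W (i + 1))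
    (c d : ℕ → ℝ)
    (hc : ∀ j ≤ m, 0 < c j) (hd : ∀ j ≤ m, 0 < d j)
    (hA₀ : ∀ x : EuclideanSpace ℝ (Fin N), c 0 * ‖x‖ ≤ ‖A₀ x‖ ∧ ‖A₀ x‖ ≤ d 0 * ‖x‖)
    (hA : ∀ i < m, ∀ x : W i, c (i + 1) * ‖x‖ ≤ ‖A i x‖ ∧ ‖A i x‖ ≤ d (i + 1) * ‖x‖) :
    (∏ j ∈ Finset.range (m + 1), c j) * |w| * Real.sqrt ((N : ℝ) / ((N : ℝ) - 1)) * (1 - π k)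
        ≤ ‖chainUp A m (A₀ δL)‖ ∧
      ‖chainUp A m (A₀ δL)‖
        ≤ (∏ j ∈ Finset.range (m + 1), d j) * |w| * Real.sqrt 2 * (1 - π k) := by
  have hN0 : Nonempty (Fin N) := ⟨k⟩
  have hZ : 0 < ∑ n, Real.exp (a n) :=
    Finset.sum_pos (fun n _ => Real.exp_pos _) Finset.univ_nonempty
  have hp : ∀ n, 0 ≤ π n := fun n => hπ n ▸ div_nonneg (Real.exp_pos _).le hZ.le
  have hsum : ∑ n, π n = 1 := by
    simp_rw [hπ]
    rw [← Finset.sum_div, div_self hZ.ne']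
  obtain ⟨hlow, hupp⟩ := norm_single_sub_bounds hN π hp hsum k
  have hnorm : ‖δL‖ = |w| * ‖EuclideanSpace.single k (1 : ℝ) - π‖ := by
    rw [hδL, norm_smul, Real.norm_eq_abs]
  have hc' : ∀ i < m, 0 ≤ c (i + 1) := fun i hi => (hc (i + 1) hi).le
  have hd' : ∀ i < m, 0 ≤ d (i + 1) := fun i hi => (hd (i + 1) hi).le
  have hcprod : 0 ≤ ∏ i ∈ Finset.range m, c (i + 1) :=
    Finset.prod_nonneg fun i hi => hc' i (Finset.mem_range.mp hi)
  have hdprod : 0 ≤ ∏ i ∈ Finset.range m, d (i + 1) :=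
    Finset.prod_nonneg fun i hi => hd' i (Finset.mem_range.mp hi)
  have hc0 : 0 ≤ c 0 := (hc 0 m.zero_le).le
  have hd0 : 0 ≤ d 0 := (hd 0 m.zero_le).le
  rw [Finset.prod_range_succ', Finset.prod_range_succ']
  constructor
  · calc (∏ i ∈ Finset.range m, c (i + 1)) * c 0 * |w| * Real.sqrt ((N : ℝ) / ((N : ℝ) - 1))
          * (1 - π k)
        = (∏ i ∈ Finset.range m, c (i + 1)) *
          (c 0 * (|w| * (Real.sqrt ((N : ℝ) / ((N : ℝ) - 1)) * (1 - π k)))) := by ring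
      _ ≤ (∏ i ∈ Finset.range m, c (i + 1)) * (c 0 * ‖δL‖) := by rw [hnorm]; gcongr
      _ ≤ (∏ i ∈ Finset.range m, c (i + 1)) * ‖A₀ δL‖ := by gcongr; exact (hA₀ δL).1
      _ ≤ ‖chainUp A m (A₀ δL)‖ :=
          prod_mul_norm_le_norm_chainUp A (fun i => c (i + 1)) m hc'
            (fun i hi x => (hA i hi x).1) _
  · calc ‖chainUp A m (A₀ δL)‖
        ≤ (∏ i ∈ Finset.range m, d (i + 1)) * ‖A₀ δL‖ :=
          norm_chainUp_le_prod_mul_norm A (fun i => d (i + 1)) m hd'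
            (fun i hi x => (hA i hi x).2) _
      _ ≤ (∏ i ∈ Finset.range m, d (i + 1)) * (d 0 * ‖δL‖) := by gcongr; exact (hA₀ δL).2
      _ ≤ (∏ i ∈ Finset.range m, d (i + 1)) *
          (d 0 * (|w| * (Real.sqrt 2 * (1 - π k)))) := by rw [hnorm]; gcongr
      _ = (∏ i ∈ Finset.range m, d (i + 1)) * d 0 * |w| * Real.sqrt 2 * (1 - π k) := by ring
end

section
/- Let N ≥ 2, let p ∈ ℝ^N be a probability vector (p(n) ≥ 0 for all n and Σ_{n=1}^N p(n) = 1), and fix an index k. Then equality ‖p − e_k‖ = √(N/(N−1)) · (1 − p(k)) holds if and only if p(n) = p(m) for all indices n, m different from k, i.e. p is uniformly distributed over the coordinates other than k. -/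
theorem Finset.sum_sum_sub_sq {ι R : Type*} [CommRing R] (s : Finset ι) (f : ι → R) :
    ∑ i ∈ s, ∑ j ∈ s, (f i - f j) ^ 2
      = 2 * (s.card * ∑ i ∈ s, f i ^ 2 - (∑ i ∈ s, f i) ^ 2) := by
  have h (i j : ι) : (f i - f j) ^ 2 = f i ^ 2 + f j ^ 2 - 2 * (f i * f j) := by ring
  simp only [h, Finset.sum_sub_distrib, Finset.sum_add_distrib, ← Finset.mul_sum,
    Finset.sum_const, nsmul_eq_mul, ← Finset.sum_mul]
  ring

/-- Equality case of the Cauchy–Schwarz inequality `sq_sum_le_card_mul_sum_sq`. -/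
theorem Finset.card_mul_sum_sq_eq_sq_sum_iff {ι : Type*} (s : Finset ι) (f : ι → ℝ) :
    s.card * ∑ i ∈ s, f i ^ 2 = (∑ i ∈ s, f i) ^ 2 ↔ ∀ i ∈ s, ∀ j ∈ s, f i = f j := by
  have h : s.card * ∑ i ∈ s, f i ^ 2 = (∑ i ∈ s, f i) ^ 2
      ↔ ∑ i ∈ s, ∑ j ∈ s, (f i - f j) ^ 2 = 0 := by
    rw [s.sum_sum_sub_sq f]
    constructor <;> intro h <;> linarith
  rw [h, Finset.sum_eq_zero_iff_of_nonneg fun i _ => Finset.sum_nonneg fun j _ => sq_nonneg _]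
  refine forall₂_congr fun i _ => ?_
  rw [Finset.sum_eq_zero_iff_of_nonneg fun j _ => sq_nonneg _]
  simp only [sq_eq_zero_iff, sub_eq_zero]

theorem EuclideanSpace.norm_sub_single_sq {ι : Type*} [Fintype ι] [DecidableEq ι]
    (x : EuclideanSpace ℝ ι) (k : ι) (a : ℝ) :
    ‖x - EuclideanSpace.single k a‖ ^ 2
      = (x k - a) ^ 2 + ∑ i ∈ Finset.univ.erase k, x i ^ 2 := by
  rw [EuclideanSpace.real_norm_sq_eq, ← Finset.add_sum_erase _ _ (Finset.mem_univ k)]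
  congr 1
  · simp
  · refine Finset.sum_congr rfl fun i hi => ?_
    simp [Finset.ne_of_mem_erase hi]

/-- **Equality case of the Cauchy–Schwarz step in the last-layer lower bound (Prop. 4.2).**
For a probability vector `p ∈ ℝ^N` (`N ≥ 2`) and an index `k`, equality
`‖p − e_k‖ = √(N/(N−1)) · (1 − p k)` holds iff `p` is uniform over the coordinates
other than `k`. -/
theorem prob_vector_sub_single_norm_lower_bound_eq_iff {N : ℕ} (hN : 2 ≤ N)
    (p : EuclideanSpace ℝ (Fin N)) (hp0 : ∀ n, 0 ≤ p n) (hp1 : ∑ n, p n = 1)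
    (k : Fin N) :
    ‖p - EuclideanSpace.single k (1 : ℝ)‖
        = Real.sqrt ((N : ℝ) / ((N : ℝ) - 1)) * (1 - p k)
      ↔ ∀ n m : Fin N, n ≠ k → m ≠ k → p n = p m := by
  have hsum : p k + ∑ n ∈ Finset.univ.erase k, p n = 1 := by
    rw [Finset.add_sum_erase _ _ (Finset.mem_univ k), hp1]
  have hle : 0 ≤ 1 - p k := by
    linarith [Finset.sum_nonneg fun n (_ : n ∈ Finset.univ.erase k) => hp0 n]
  have hcard : ((Finset.univ.erase k).card : ℝ) = N - 1 := by
    rw [Finset.card_erase_of_mem (Finset.mem_univ k), Finset.card_fin,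
      Nat.cast_sub (by omega), Nat.cast_one]
  have hpos : (0 : ℝ) < N - 1 := by
    have : (2 : ℝ) ≤ N := by exact_mod_cast hN
    linarith
  have hcs := (Finset.univ.erase k).card_mul_sum_sq_eq_sq_sum_iff p
  rw [hcard, eq_sub_of_add_eq' hsum] at hcs
  rw [← sq_eq_sq₀ (norm_nonneg _) (mul_nonneg (Real.sqrt_nonneg _) hle), mul_pow,
    Real.sq_sqrt (by positivity), EuclideanSpace.norm_sub_single_sq, div_mul_eq_mul_div,
    eq_div_iff hpos.ne']
  trans ((N : ℝ) - 1) * ∑ n ∈ Finset.univ.erase k, p n ^ 2 = (1 - p k) ^ 2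
  · constructor <;> intro h <;> linarith
  · rw [hcs]
    simp only [Finset.mem_erase, Finset.mem_univ, and_true]
    exact ⟨fun h n m hn hm => h n hn m hm, fun h n hn m hm => h n m hn hm⟩
end

section
/- Let N ≥ 2, let a ∈ ℝ^N, let π ∈ ℝ^N be its softmax, π(n) = exp(a(n)) / Σ_{m=1}^N exp(a(m)), fix an index k, and let w ∈ ℝ. Then the Euclidean norm of δ_L = w · (e_k − π) satisfies |w| · √(N/(N−1)) · (1 − π(k)) ≤ ‖δ_L‖ ≤ |w| · √2 · (1 − π(k)), where e_k is the k-th standard basis vector of ℝ^N. -/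
open Finset in
/-- The squared distance from a basis vector, with the coordinate `k` split off. -/
theorem norm_single_one_sub_sq {ι : Type*} [Fintype ι] [DecidableEq ι]
    (p : EuclideanSpace ℝ ι) (k : ι) :
    ‖EuclideanSpace.single k (1 : ℝ) - p‖ ^ 2 = (1 - p k) ^ 2 + ∑ n ∈ univ.erase k, p n ^ 2 := by
  rw [EuclideanSpace.real_norm_sq_eq, ← add_sum_erase univ _ (mem_univ k)]
  congr 1
  · simp
  · refine sum_congr rfl fun n hn => ?_
    simp [ne_of_mem_erase hn]

open Finset in
theorem sum_erase_eq_one_sub {ι : Type*} [Fintype ι] [DecidableEq ι]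
    {p : ι → ℝ} (hp : ∑ n, p n = 1) (k : ι) : ∑ n ∈ univ.erase k, p n = 1 - p k := by
  rw [← hp, ← add_sum_erase univ p (mem_univ k), add_sub_cancel_left]

open Finset in
theorem sqrt_mul_one_sub_le_norm_single_one_sub {ι : Type*} [Fintype ι] [DecidableEq ι]
    (hι : 2 ≤ Fintype.card ι) {p : EuclideanSpace ℝ ι} (hp : ∑ n, p n = 1) (k : ι) :
    √((Fintype.card ι : ℝ) / ((Fintype.card ι : ℝ) - 1)) * (1 - p k) ≤
      ‖EuclideanSpace.single k (1 : ℝ) - p‖ := by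
  have hcard : (2 : ℝ) ≤ Fintype.card ι := by exact_mod_cast hι
  have hpos : (0 : ℝ) < Fintype.card ι - 1 := by linarith
  have hcs := sq_sum_le_card_mul_sum_sq (s := univ.erase k) (f := fun n => p n)
  rw [sum_erase_eq_one_sub hp, card_erase_of_mem (mem_univ k), card_univ,
    Nat.cast_pred (by lia)] at hcs
  refine le_of_sq_le_sq ?_ (norm_nonneg _)
  rw [mul_pow, Real.sq_sqrt (by positivity), norm_single_one_sub_sq, div_mul_eq_mul_div,
    div_le_iff₀ hpos]
  linarith

open Finset in
theorem norm_single_one_sub_le {ι : Type*} [Fintype ι] [DecidableEq ι]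
    {p : EuclideanSpace ℝ ι} (hp₀ : ∀ n, 0 ≤ p n) (hp : ∑ n, p n = 1) (k : ι) :
    ‖EuclideanSpace.single k (1 : ℝ) - p‖ ≤ √2 * (1 - p k) := by
  have hsum := sum_erase_eq_one_sub hp k
  have hk : 0 ≤ 1 - p k := hsum ▸ sum_nonneg fun n _ => hp₀ n
  have hsq : ∑ n ∈ univ.erase k, p n ^ 2 ≤ (1 - p k) ^ 2 :=
    hsum ▸ sum_sq_le_sq_sum_of_nonneg fun n _ => hp₀ n
  refine le_of_sq_le_sq ?_ (by positivity)
  rw [mul_pow, Real.sq_sqrt zero_le_two, norm_single_one_sub_sq]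
  linarith

/-- **Last-layer case of Proposition 4.2.**
Let `π` be the softmax of the logits `a ∈ ℝ^N` (`N ≥ 2`), let `k` be an index and `w ∈ ℝ`.
Then the Euclidean norm of `δ_L = w • (e_k − π)` satisfies
`|w| · √(N/(N−1)) · (1 − π k) ≤ ‖δ_L‖ ≤ |w| · √2 · (1 − π k)`. -/
theorem last_layer_gradient_norm_bounds {N : ℕ} (hN : 2 ≤ N)
    (a π : EuclideanSpace ℝ (Fin N))
    (hπ : ∀ n, π n = Real.exp (a n) / ∑ m, Real.exp (a m))
    (k : Fin N) (w : ℝ) :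
    |w| * Real.sqrt ((N : ℝ) / ((N : ℝ) - 1)) * (1 - π k)
        ≤ ‖w • (EuclideanSpace.single k (1 : ℝ) - π)‖ ∧
      ‖w • (EuclideanSpace.single k (1 : ℝ) - π)‖
        ≤ |w| * Real.sqrt 2 * (1 - π k) := by
  have : Nonempty (Fin N) := ⟨k⟩
  have hZ : 0 < ∑ m, Real.exp (a m) :=
    Finset.sum_pos (fun m _ => Real.exp_pos _) Finset.univ_nonempty
  have hπ₀ : ∀ n, 0 ≤ π n := fun n => by rw [hπ]; positivity
  have hπ₁ : ∑ n, π n = 1 := by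
    simp_rw [hπ, ← Finset.sum_div]
    exact div_self hZ.ne'
  have hlower := sqrt_mul_one_sub_le_norm_single_one_sub (by simpa using hN) hπ₁ k
  rw [Fintype.card_fin] at hlower
  rw [norm_smul, Real.norm_eq_abs, mul_assoc, mul_assoc]
  exact ⟨mul_le_mul_of_nonneg_left hlower (abs_nonneg w),
    mul_le_mul_of_nonneg_left (norm_single_one_sub_le hπ₀ hπ₁ k) (abs_nonneg w)⟩
end
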